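/- Let X be a Banach function space over (Ω,μ). Then X is reflexive if and only if X has the Fatou property and both X and its Köthe dual X' are order-continuous. -/

import Mathlib

open MeasureTheory Filter Set Topology

/-- A quasi-Banach function space over the measure space `(Ω, μ)`:
a complete quasi-normed vector subspace of `L⁰(Ω)` satisfying the
ideal property and the saturation property. -/
structure QBFS {Ω : Type*} [MeasurableSpace Ω] (μ : Measure Ω) where
  carrier : Set (Ω → ℝ)
  qnorm : (Ω → ℝ) → ℝ
  K : ℝ
  one_le_K : 1 ≤ K
  aemeasurable_mem : ∀ f ∈ carrier, AEMeasurable f μ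
  zero_mem : (0 : Ω → ℝ) ∈ carrier
  add_mem : ∀ f ∈ carrier, ∀ g ∈ carrier, f + g ∈ carrier
  smul_mem : ∀ (c : ℝ), ∀ f ∈ carrier, c • f ∈ carrier
  qnorm_nonneg : ∀ f ∈ carrier, 0 ≤ qnorm f
  qnorm_eq_zero_iff : ∀ f ∈ carrier, (qnorm f = 0 ↔ f =ᵐ[μ] 0)
  qnorm_smul : ∀ (c : ℝ), ∀ f ∈ carrier, qnorm (c • f) = |c| * qnorm f
  qnorm_triangle : ∀ f ∈ carrier, ∀ g ∈ carrier, qnorm (f + g) ≤ K * (qnorm f + qnorm g)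
  ideal : ∀ f ∈ carrier, ∀ g : Ω → ℝ, AEMeasurable g μ →
      (∀ᵐ x ∂μ, |g x| ≤ |f x|) → g ∈ carrier ∧ qnorm g ≤ qnorm f
  saturated : ∀ E : Set Ω, MeasurableSet E → 0 < μ E →
      ∃ F, F ⊆ E ∧ MeasurableSet F ∧ 0 < μ F ∧ F.indicator (fun _ => (1 : ℝ)) ∈ carrier
  complete : ∀ f : ℕ → Ω → ℝ, (∀ n, f n ∈ carrier) →
      (∀ ε > 0, ∃ N, ∀ j ≥ N, ∀ k ≥ N, qnorm (f j - f k) < ε) →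
      ∃ g ∈ carrier, Tendsto (fun n => qnorm (f n - g)) atTop (𝓝 0)

namespace QBFS

variable {Ω : Type*} [MeasurableSpace Ω] {μ : Measure Ω}

/-- `X` is a *Banach* function space if its quasi-norm is a norm. -/
def IsBanach (X : QBFS μ) : Prop :=
  ∀ f ∈ X.carrier, ∀ g ∈ X.carrier, X.qnorm (f + g) ≤ X.qnorm f + X.qnorm g

/-- The Köthe dual `X'` of `X`. -/
def kotheDual (X : QBFS μ) : Set (Ω → ℝ) :=
  {g | AEMeasurable g μ ∧ ∀ f ∈ X.carrier, Integrable (fun x => f x * g x) μ}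

/-- The Köthe dual norm `‖g‖_{X'} = sup_{‖f‖_X = 1} ‖fg‖_{L¹}`. -/
noncomputable def dualNorm (X : QBFS μ) (g : Ω → ℝ) : ℝ :=
  sSup ((fun f => ∫ x, |f x * g x| ∂μ) '' {f | f ∈ X.carrier ∧ X.qnorm f = 1})

/-- The Fatou property. -/
def Fatou (X : QBFS μ) : Prop :=
  ∀ (f : ℕ → Ω → ℝ) (g : Ω → ℝ), (∀ n, f n ∈ X.carrier) → AEMeasurable g μ →
    (∀ᵐ x ∂μ, 0 ≤ f 0 x ∧ Monotone (fun n => f n x) ∧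
      Tendsto (fun n => f n x) atTop (𝓝 (g x))) →
    BddAbove (Set.range fun n => X.qnorm (f n)) →
    g ∈ X.carrier ∧ X.qnorm g = ⨆ n, X.qnorm (f n)

/-- Order-continuity: if `f_n ↓ 0` a.e. then `‖f_n‖_X → 0`. -/
def OrderContinuous (X : QBFS μ) : Prop :=
  ∀ f : ℕ → Ω → ℝ, (∀ n, f n ∈ X.carrier) →
    (∀ᵐ x ∂μ, Antitone (fun n => f n x) ∧ Tendsto (fun n => f n x) atTop (𝓝 0)) →
    Tendsto (fun n => X.qnorm (f n)) atTop (𝓝 0)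

end QBFS

variable {Ω : Type*} [MeasurableSpace Ω] {μ : Measure Ω}

/-- A bounded linear functional on `X`. -/
def IsBddLinFunctional (X : QBFS μ) (φ : (Ω → ℝ) → ℝ) : Prop :=
  (∀ f ∈ X.carrier, ∀ g ∈ X.carrier, φ (f + g) = φ f + φ g) ∧
  (∀ (c : ℝ), ∀ f ∈ X.carrier, φ (c • f) = c * φ f) ∧
  (∃ C : ℝ, 0 ≤ C ∧ ∀ f ∈ X.carrier, |φ f| ≤ C * X.qnorm f)

/-- The operator norm on `X*`. -/
noncomputable def opNorm (X : QBFS μ) (φ : (Ω → ℝ) → ℝ) : ℝ :=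
  sInf {C | 0 ≤ C ∧ ∀ f ∈ X.carrier, |φ f| ≤ C * X.qnorm f}

/-- A bounded linear functional on the Banach dual `X*`. -/
def IsBddLinOnDual (X : QBFS μ) (Φ : (((Ω → ℝ) → ℝ)) → ℝ) : Prop :=
  (∀ φ ψ, IsBddLinFunctional X φ → IsBddLinFunctional X ψ → Φ (φ + ψ) = Φ φ + Φ ψ) ∧
  (∀ (c : ℝ) (φ), IsBddLinFunctional X φ → Φ (c • φ) = c * Φ φ) ∧
  (∃ C : ℝ, 0 ≤ C ∧ ∀ φ, IsBddLinFunctional X φ → |Φ φ| ≤ C * opNorm X φ)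

/-- `X` is reflexive: every bounded linear functional on `X*` is evaluation at
some element of `X`. -/
def IsReflexive (X : QBFS μ) : Prop :=
  ∀ Φ : ((Ω → ℝ) → ℝ) → ℝ, IsBddLinOnDual X Φ →
    ∃ f ∈ X.carrier, ∀ φ, IsBddLinFunctional X φ → Φ φ = φ f

/-- Order-continuity of the Köthe dual `X'`. -/
def DualOrderContinuous (X : QBFS μ) : Prop :=
  ∀ g : ℕ → Ω → ℝ, (∀ n, g n ∈ X.kotheDual) →
    (∀ᵐ x ∂μ, Antitone (fun n => g n x) ∧ Tendsto (fun n => g n x) atTop (𝓝 0)) →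
    Tendsto (fun n => X.dualNorm (g n)) atTop (𝓝 0)

namespace QBFS

section Basic

variable {X : QBFS μ} {f g : Ω → ℝ}

lemma neg_mem (hf : f ∈ X.carrier) : -f ∈ X.carrier := by
  simpa using X.smul_mem (-1) f hf

lemma sub_mem (hf : f ∈ X.carrier) (hg : g ∈ X.carrier) : f - g ∈ X.carrier := by
  simpa [sub_eq_add_neg] using X.add_mem f hf _ (neg_mem hg)

lemma qnorm_zero : X.qnorm 0 = 0 :=
  (X.qnorm_eq_zero_iff 0 X.zero_mem).2 ae_eq_rfl

lemma qnorm_neg (hf : f ∈ X.carrier) : X.qnorm (-f) = X.qnorm f := by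
  simpa using X.qnorm_smul (-1) f hf

lemma qnorm_sub_comm (hf : f ∈ X.carrier) (hg : g ∈ X.carrier) :
    X.qnorm (f - g) = X.qnorm (g - f) := by
  rw [← neg_sub, qnorm_neg (sub_mem hg hf)]

lemma abs_mem (hf : f ∈ X.carrier) : (fun x => |f x|) ∈ X.carrier :=
  (X.ideal f hf _ (X.aemeasurable_mem f hf).abs (by simp)).1

lemma qnorm_abs (hf : f ∈ X.carrier) : X.qnorm (fun x => |f x|) = X.qnorm f :=
  le_antisymm (X.ideal f hf _ (X.aemeasurable_mem f hf).abs (by simp)).2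
    (X.ideal _ (abs_mem hf) f (X.aemeasurable_mem f hf) (by simp)).2

lemma mem_congr (hf : f ∈ X.carrier) (h : f =ᵐ[μ] g) : g ∈ X.carrier :=
  (X.ideal f hf g ((X.aemeasurable_mem f hf).congr h) (h.mono fun x hx => by rw [hx])).1

lemma sum_mem {ι : Type*} (s : Finset ι) {u : ι → Ω → ℝ} (hu : ∀ i ∈ s, u i ∈ X.carrier) :
    ∑ i ∈ s, u i ∈ X.carrier :=
  Finset.sum_induction u (· ∈ X.carrier) (fun a b ha hb => X.add_mem a ha b hb) X.zero_mem hu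

lemma qnorm_sum_le (hB : X.IsBanach) {ι : Type*} (s : Finset ι) {u : ι → Ω → ℝ}
    (hu : ∀ i ∈ s, u i ∈ X.carrier) :
    X.qnorm (∑ i ∈ s, u i) ≤ ∑ i ∈ s, X.qnorm (u i) := by
  classical
  induction s using Finset.induction_on with
  | empty => simp [qnorm_zero]
  | insert a s ha ih =>
    rw [Finset.sum_insert ha, Finset.sum_insert ha]
    have hs : ∀ i ∈ s, u i ∈ X.carrier := fun i hi => hu i (Finset.mem_insert_of_mem hi)
    exact (hB _ (hu a (Finset.mem_insert_self a s)) _ (sum_mem s hs)).trans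
      (add_le_add_right (ih hs) _)

/-- Pointwise inequalities `f ≤ h` are stable under norm limits in `h`. -/
lemma ae_le_of_forall_qnorm_sub_lt (hf : f ∈ X.carrier) (hg : g ∈ X.carrier)
    (h : ∀ ε > 0, ∃ u ∈ X.carrier, (∀ᵐ x ∂μ, f x ≤ u x) ∧ X.qnorm (u - g) < ε) :
    ∀ᵐ x ∂μ, f x ≤ g x := by
  have hm : AEMeasurable (fun x => max (f x - g x) 0) μ :=
    ((X.aemeasurable_mem f hf).sub (X.aemeasurable_mem g hg)).max aemeasurable_const
  have hbound : ∀ u ∈ X.carrier, (∀ᵐ x ∂μ, f x ≤ u x) →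
      (fun x => max (f x - g x) 0) ∈ X.carrier ∧
        X.qnorm (fun x => max (f x - g x) 0) ≤ X.qnorm (u - g) := fun u hu hfu =>
    X.ideal _ (sub_mem hu hg) _ hm <| hfu.mono fun x hx => by
      rw [abs_of_nonneg (le_max_right _ _)]
      exact max_le ((sub_le_sub_right hx _).trans (le_abs_self _)) (abs_nonneg _)
  have hmem := (hbound f hf (ae_of_all _ fun _ => le_rfl)).1
  have hzero : X.qnorm (fun x => max (f x - g x) 0) = 0 := by
    refine le_antisymm (le_of_forall_pos_lt_add fun ε hε => ?_) (X.qnorm_nonneg _ hmem)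
    obtain ⟨u, hu, hfu, hlt⟩ := h ε hε
    simpa using (hbound u hu hfu).2.trans_lt hlt
  filter_upwards [(X.qnorm_eq_zero_iff _ hmem).1 hzero] with x hx
  have : f x - g x ≤ 0 := (le_max_left _ _).trans hx.le
  linarith

/-- An absolutely summable sequence is dominated by a single element. -/
lemma exists_dominating (hB : X.IsBanach) {u : ℕ → Ω → ℝ} (hu : ∀ n, u n ∈ X.carrier)
    (hs : Summable fun n => X.qnorm (u n)) :
    ∃ F ∈ X.carrier, ∀ n, ∀ᵐ x ∂μ, |u n x| ≤ F x := by
  set S : ℕ → Ω → ℝ := fun n => ∑ i ∈ Finset.range n, fun x => |u i x| with hS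
  have hSm : ∀ n, S n ∈ X.carrier := fun n => sum_mem _ fun i _ => abs_mem (hu i)
  have hdiff : ∀ m n, m ≤ n → X.qnorm (S n - S m) ≤
      ∑ i ∈ Finset.range n, X.qnorm (u i) - ∑ i ∈ Finset.range m, X.qnorm (u i) := by
    intro m n hmn
    rw [hS]
    simp only
    rw [← Finset.sum_Ico_eq_sub _ hmn, ← Finset.sum_Ico_eq_sub _ hmn]
    refine (qnorm_sum_le hB _ fun i _ => abs_mem (hu i)).trans (le_of_eq ?_)
    exact Finset.sum_congr rfl fun i _ => qnorm_abs (hu i)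
  have hC := Metric.cauchySeq_iff.1 hs.hasSum.tendsto_sum_nat.cauchySeq
  obtain ⟨F, hF, hlim⟩ := X.complete S hSm (by
    intro ε hε
    obtain ⟨N, hN⟩ := hC ε hε
    refine ⟨N, fun j hj k hk => ?_⟩
    rcases le_total k j with hkj | hjk
    · exact (hdiff k j hkj).trans_lt ((le_abs_self _).trans_lt (hN j hj k hk))
    · rw [qnorm_sub_comm (hSm j) (hSm k)]
      exact (hdiff j k hjk).trans_lt ((le_abs_self _).trans_lt (hN k hk j hj)))
  refine ⟨F, hF, fun n => ?_⟩
  refine ae_le_of_forall_qnorm_sub_lt (abs_mem (hu n)) hF fun ε hε => ?_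
  obtain ⟨m, hm, hmn⟩ := ((hlim.eventually_lt_const hε).and (eventually_ge_atTop (n + 1))).exists
  refine ⟨S m, hSm m, ae_of_all _ fun x => ?_, hm⟩
  simp only [hS, Finset.sum_apply]
  exact Finset.single_le_sum (f := fun i => |u i x|) (fun i _ => abs_nonneg _)
    (Finset.mem_range.2 (by omega))

/-- A countable family of elements of `X` is dominated, up to scalars, by a single element. -/
lemma exists_scaled_dominating (hB : X.IsBanach) {u : ℕ → Ω → ℝ} (hu : ∀ n, u n ∈ X.carrier) :
    ∃ F ∈ X.carrier, ∀ n, ∃ c > 0, ∀ᵐ x ∂μ, c * |u n x| ≤ F x := by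
  have hpos : ∀ n, 0 < X.qnorm (u n) + 1 := fun n => by
    linarith [X.qnorm_nonneg _ (hu n)]
  set c : ℕ → ℝ := fun n => (1 / 2) ^ n / (X.qnorm (u n) + 1)
  have hc : ∀ n, 0 < c n := fun n => div_pos (by positivity) (hpos n)
  obtain ⟨F, hF, hle⟩ := exists_dominating hB (u := fun n => c n • u n)
    (fun n => X.smul_mem _ _ (hu n)) (by
      refine Summable.of_nonneg_of_le (fun n => X.qnorm_nonneg _ (X.smul_mem _ _ (hu n)))
        (fun n => ?_) (summable_geometric_of_lt_one (by norm_num) (by norm_num : (1 / 2 : ℝ) < 1))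
      rw [X.qnorm_smul _ _ (hu n), abs_of_pos (hc n), div_mul_eq_mul_div, div_le_iff₀ (hpos n)]
      exact mul_le_mul_of_nonneg_left (by linarith) (by positivity))
  refine ⟨F, hF, fun n => ⟨c n, hc n, (hle n).mono fun x hx => ?_⟩⟩
  simpa [abs_mul, abs_of_pos (hc n)] using hx

/-- A Banach function space over a σ-finite measure has a weak order unit. -/
lemma exists_weakUnit [SigmaFinite μ] (hB : X.IsBanach) :
    ∃ w ∈ X.carrier, Measurable w ∧ ∀ x, 0 < w x := by
  set m := μ.toFinite
  set S : Set ENNReal := (fun u : Ω → ℝ => m (Function.support u)) '' X.carrier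
  obtain ⟨r, -, hrlim, hrS⟩ := exists_seq_tendsto_sSup (S := S) ⟨_, 0, X.zero_mem, rfl⟩
    (OrderTop.bddAbove S)
  choose u hu hur using hrS
  obtain ⟨F₀, hF₀, hdom⟩ := exists_scaled_dominating hB hu
  set F := (X.aemeasurable_mem F₀ hF₀).mk F₀
  have hFm : Measurable F := (X.aemeasurable_mem F₀ hF₀).measurable_mk
  have hFF : F₀ =ᵐ[μ] F := (X.aemeasurable_mem F₀ hF₀).ae_eq_mk
  have hF : F ∈ X.carrier := mem_congr hF₀ hFF
  have hsup : sSup S ≤ m (Function.support F) := by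
    refine le_of_tendsto' hrlim fun n => ?_
    rw [← hur n]
    obtain ⟨c, hc, hle⟩ := hdom n
    refine measure_mono_ae ?_
    rw [ae_toFinite]
    filter_upwards [hle, hFF] with x hx hx' hux
    have : 0 < c * |u n x| := mul_pos hc (abs_pos.2 hux)
    exact (hx' ▸ this.trans_le hx).ne'
  have hE : MeasurableSet {x | F x = 0} := hFm (measurableSet_singleton 0)
  have hnull : μ {x | F x = 0} = 0 := by
    by_contra hne
    obtain ⟨G, hGE, hG, hGpos, hGX⟩ := X.saturated _ hE (pos_iff_ne_zero.2 hne)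
    have hmem := X.add_mem _ (abs_mem hF) _ hGX
    have hsub : Function.support F ∪ G ⊆
        Function.support ((fun x => |F x|) + G.indicator fun _ => (1 : ℝ)) := by
      rintro x (hx | hx)
      · have h1 : 0 < |F x| := abs_pos.2 hx
        have h2 : 0 ≤ G.indicator (fun _ => (1 : ℝ)) x := indicator_nonneg (by simp) x
        exact (add_pos_of_pos_of_nonneg h1 h2).ne'
      · simp [indicator_of_mem hx, show F x = 0 from hGE hx]
    have hdisj : Disjoint (Function.support F) G :=
      Set.disjoint_left.2 fun x hx hxG => hx (hGE hxG)
    have hle : m (Function.support F) + m G ≤ m (Function.support F) := by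
      rw [← measure_union hdisj hG]
      exact (measure_mono hsub).trans ((le_sSup (mem_image_of_mem _ hmem)).trans hsup)
    have hmG : m G = 0 := by
      by_contra hne'
      exact (ENNReal.lt_add_right (measure_ne_top m _) hne').not_ge hle
    exact hGpos.ne' (toFinite_apply_eq_zero_iff.1 hmG)
  refine ⟨fun x => if F x = 0 then 1 else |F x|, mem_congr (abs_mem hF) ?_,
    Measurable.ite hE measurable_const hFm.abs, fun x => ?_⟩
  · have : ∀ᵐ x ∂μ, F x ≠ 0 := by simpa [ae_iff] using hnull
    filter_upwards [this] with x hx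
    simp [hx]
  · dsimp only
    split_ifs with h
    · exact one_pos
    · exact abs_pos.2 h

end Basic

section OrderContinuity

variable {X : QBFS μ} {φ : (Ω → ℝ) → ℝ}

/-- Dominated convergence in an order-continuous space. -/
lemma OrderContinuous.tendsto_qnorm_sub (hX : X.OrderContinuous) {u : ℕ → Ω → ℝ} {f F : Ω → ℝ}
    (hu : ∀ n, AEMeasurable (u n) μ) (hf : AEMeasurable f μ) (hF : F ∈ X.carrier)
    (hle : ∀ n, ∀ᵐ x ∂μ, |u n x| ≤ F x)
    (hlim : ∀ᵐ x ∂μ, Tendsto (fun n => u n x) atTop (𝓝 (f x))) :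
    Tendsto (fun n => X.qnorm (u n - f)) atTop (𝓝 0) := by
  have hle' : ∀ᵐ x ∂μ, ∀ n, |u n x - f x| ≤ 2 * F x := by
    filter_upwards [ae_all_iff.2 hle, hlim] with x hx hx' n
    have : |f x| ≤ F x := le_of_tendsto' hx'.abs hx
    linarith [abs_sub (u n x) (f x), hx n]
  have hbdd : ∀ᵐ x ∂μ, ∀ n, BddAbove (range fun k => |u (n + k) x - f x|) := by
    filter_upwards [hle'] with x hx n
    exact ⟨2 * F x, by rintro _ ⟨k, rfl⟩; exact hx _⟩
  set v : ℕ → Ω → ℝ := fun n x => ⨆ k, |u (n + k) x - f x|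
  have hv0 : ∀ n x, 0 ≤ v n x := fun n x => Real.iSup_nonneg fun k => abs_nonneg _
  have hvm : ∀ n, AEMeasurable (v n) μ := fun n => AEMeasurable.iSup fun k => ((hu _).sub hf).abs
  have hv : ∀ n, v n ∈ X.carrier := fun n =>
    (X.ideal _ (X.smul_mem 2 F hF) _ (hvm n) (hle'.mono fun x hx => by
      rw [abs_of_nonneg (hv0 n x)]
      exact (ciSup_le fun k => hx _).trans (le_abs_self _))).1
  have hvlim : Tendsto (fun n => X.qnorm (v n)) atTop (𝓝 0) := by
    refine hX v hv ?_
    filter_upwards [hbdd, hlim] with x hx hx'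
    refine ⟨antitone_nat_of_succ_le fun n => ciSup_le fun k => ?_, ?_⟩
    · have := le_ciSup (hx n) (k + 1)
      rwa [show n + (k + 1) = n + 1 + k by ring] at this
    · refine Metric.tendsto_atTop.2 fun ε hε => ?_
      obtain ⟨N, hN⟩ := Metric.tendsto_atTop.1 hx' (ε / 2) (by positivity)
      refine ⟨N, fun n hn => ?_⟩
      rw [Real.dist_eq, sub_zero, abs_of_nonneg (hv0 n x)]
      refine (ciSup_le fun k => ?_).trans_lt (half_lt_self hε)
      exact (hN (n + k) (by omega)).le
  have hcmp : ∀ n, u n - f ∈ X.carrier ∧ X.qnorm (u n - f) ≤ X.qnorm (v n) := fun n =>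
    X.ideal _ (hv n) _ ((hu n).sub hf) (hbdd.mono fun x hx => by
      simpa [abs_of_nonneg (hv0 n x)] using le_ciSup (hx n) 0)
  exact squeeze_zero (fun n => X.qnorm_nonneg _ (hcmp n).1) (fun n => (hcmp n).2) hvlim

end OrderContinuity

end QBFS

section Functionals

variable {X : QBFS μ} {φ : (Ω → ℝ) → ℝ} {f g : Ω → ℝ}

lemma IsBddLinFunctional.map_sub (hφ : IsBddLinFunctional X φ) (hf : f ∈ X.carrier)
    (hg : g ∈ X.carrier) : φ (f - g) = φ f - φ g := by
  have h1 := hφ.2.1 (-1) g hg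
  have h2 := hφ.1 f hf ((-1 : ℝ) • g) (X.smul_mem _ _ hg)
  rw [h1] at h2
  rw [show f - g = f + (-1 : ℝ) • g by ext; simp [sub_eq_add_neg], h2]
  ring

lemma IsBddLinFunctional.map_zero (hφ : IsBddLinFunctional X φ) : φ 0 = 0 := by
  simpa using hφ.2.1 0 0 X.zero_mem

lemma IsBddLinFunctional.map_sum (hφ : IsBddLinFunctional X φ) {ι : Type*} (s : Finset ι)
    {u : ι → Ω → ℝ} (hu : ∀ i ∈ s, u i ∈ X.carrier) : φ (∑ i ∈ s, u i) = ∑ i ∈ s, φ (u i) := by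
  classical
  induction s using Finset.induction_on with
  | empty => simp [hφ.map_zero]
  | insert a s ha ih =>
    have hs : ∀ i ∈ s, u i ∈ X.carrier := fun i hi => hu i (Finset.mem_insert_of_mem hi)
    rw [Finset.sum_insert ha, Finset.sum_insert ha, ← ih hs]
    exact hφ.1 _ (hu a (Finset.mem_insert_self a s)) _ (QBFS.sum_mem s hs)

lemma IsBddLinFunctional.map_eq_zero (hφ : IsBddLinFunctional X φ) (hf : f ∈ X.carrier)
    (h : f =ᵐ[μ] 0) : φ f = 0 := by
  obtain ⟨C, -, hC⟩ := hφ.2.2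
  have := hC f hf
  rw [(X.qnorm_eq_zero_iff f hf).2 h, mul_zero] at this
  exact abs_nonpos_iff.1 this

lemma IsBddLinFunctional.map_congr (hφ : IsBddLinFunctional X φ) (hf : f ∈ X.carrier)
    (h : f =ᵐ[μ] g) : φ f = φ g := by
  have hg := QBFS.mem_congr hf h
  refine sub_eq_zero.1 ?_
  rw [← hφ.map_sub hf hg]
  exact hφ.map_eq_zero (QBFS.sub_mem hf hg) (h.mono fun x hx => by simp [hx])

lemma IsBddLinFunctional.tendsto (hφ : IsBddLinFunctional X φ) {u : ℕ → Ω → ℝ}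
    (hu : ∀ n, u n ∈ X.carrier) (hf : f ∈ X.carrier)
    (h : Tendsto (fun n => X.qnorm (u n - f)) atTop (𝓝 0)) :
    Tendsto (fun n => φ (u n)) atTop (𝓝 (φ f)) := by
  obtain ⟨C, -, hC⟩ := hφ.2.2
  rw [tendsto_iff_norm_sub_tendsto_zero]
  refine squeeze_zero (fun n => norm_nonneg _) (fun n => ?_) (by simpa using h.const_mul C)
  rw [← hφ.map_sub (hu n) hf]
  exact hC _ (QBFS.sub_mem (hu n) hf)

lemma QBFS.indicator_mem (hf : f ∈ X.carrier) {E : Set Ω} (hE : MeasurableSet E) :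
    E.indicator f ∈ X.carrier :=
  (X.ideal f hf _ ((X.aemeasurable_mem f hf).indicator hE)
    (ae_of_all _ fun x => norm_indicator_le_norm_self f x)).1

/-- The set function `E ↦ φ (1_E w)` is countably additive when `X` is order-continuous. -/
lemma IsBddLinFunctional.hasSum_indicator (hφ : IsBddLinFunctional X φ)
    (hX : X.OrderContinuous) {w : Ω → ℝ} (hw : w ∈ X.carrier) {E : ℕ → Set Ω}
    (hE : ∀ i, MeasurableSet (E i)) (hd : Pairwise (Function.onFun Disjoint E)) :
    HasSum (fun i => φ ((E i).indicator w)) (φ ((⋃ i, E i).indicator w)) := by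
  obtain ⟨C, hC0, hC⟩ := hφ.2.2
  set T : ℕ → Set Ω := fun n => ⋃ i ≥ n, E i
  have hT : ∀ n, MeasurableSet (T n) := fun n =>
    MeasurableSet.iUnion fun i => MeasurableSet.iUnion fun _ => hE i
  have hwm := X.aemeasurable_mem w hw
  have hlim : Tendsto (fun n => X.qnorm ((T n).indicator w)) atTop (𝓝 0) := by
    have := hX.tendsto_qnorm_sub (u := fun n => (T n).indicator w) (f := 0)
      (fun n => hwm.indicator (hT n)) aemeasurable_zero (QBFS.abs_mem hw)
      (fun n => ae_of_all _ fun x => norm_indicator_le_norm_self w x)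
      (ae_of_all _ fun x => ?_)
    · simpa using this
    · refine tendsto_const_nhds.congr' ?_
      by_cases hx : ∃ i, x ∈ E i
      · obtain ⟨i, hi⟩ := hx
        filter_upwards [eventually_gt_atTop i] with n hn
        refine (indicator_of_notMem ?_ _).symm
        simp only [T, mem_iUnion, not_exists]
        intro j hj hxj
        exact Set.disjoint_left.1 (hd (show i ≠ j by omega)) hi hxj
      · refine Eventually.of_forall fun n => (indicator_of_notMem ?_ _).symm
        simp only [T, mem_iUnion, not_exists]
        exact fun j _ hxj => hx ⟨j, hxj⟩
  have hU : (⋃ i, E i).indicator w ∈ X.carrier := QBFS.indicator_mem hw (.iUnion hE)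
  refine Metric.tendsto_atTop.2 fun ε hε => ?_
  have hlim' : Tendsto (fun n => C * X.qnorm ((T n).indicator w)) atTop (𝓝 0) := by
    simpa using hlim.const_mul C
  obtain ⟨N, hN⟩ := (hlim'.eventually_lt_const hε).exists
  refine ⟨Finset.range N, fun s hs => lt_of_le_of_lt ?_ hN⟩
  have hsm : ∀ i ∈ s, (E i).indicator w ∈ X.carrier := fun i _ => QBFS.indicator_mem hw (hE i)
  rw [Real.dist_eq, ← hφ.map_sum s hsm, ← hφ.map_sub (QBFS.sum_mem s hsm) hU]
  have hmem := QBFS.sub_mem (QBFS.sum_mem s hsm) hU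
  refine (hC _ hmem).trans (mul_le_mul_of_nonneg_left ?_ hC0)
  refine (X.ideal _ (QBFS.indicator_mem hw (hT N)) _ (X.aemeasurable_mem _ hmem)
    (ae_of_all _ fun x => ?_)).2
  simp only [Pi.sub_apply, Finset.sum_apply]
  by_cases hx : ∃ i, x ∈ E i
  · obtain ⟨i, hi⟩ := hx
    have hother : ∀ j, j ≠ i → (E j).indicator w x = 0 := fun j hj =>
      indicator_of_notMem (fun hxj => Set.disjoint_left.1 (hd hj) hxj hi) _
    rw [indicator_of_mem (mem_iUnion.2 ⟨i, hi⟩)]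
    by_cases his : i ∈ s
    · rw [Finset.sum_eq_single i (fun j _ hj => hother j hj) (fun h => absurd his h),
        indicator_of_mem hi]
      simp
    · rw [Finset.sum_eq_zero fun j hj => hother j (fun h => his (h ▸ hj)), zero_sub, abs_neg]
      have hiN : N ≤ i := by
        by_contra h
        exact his (hs (Finset.mem_range.2 (by omega)))
      rw [indicator_of_mem (show x ∈ T N from mem_iUnion₂.2 ⟨i, hiN, hi⟩)]
  · have h0 : ∀ j, (E j).indicator w x = 0 := fun j =>
      indicator_of_notMem (fun hxj => hx ⟨j, hxj⟩) _
    rw [Finset.sum_eq_zero fun j _ => h0 j, indicator_of_notMem (by simpa using hx)]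
    simp

/-- A bounded functional on an order-continuous space has a density against every element. -/
lemma IsBddLinFunctional.exists_density [SigmaFinite μ] (hφ : IsBddLinFunctional X φ)
    (hX : X.OrderContinuous) {w : Ω → ℝ} (hw : w ∈ X.carrier) :
    ∃ h : Ω → ℝ, Measurable h ∧ Integrable h μ ∧
      ∀ E, MeasurableSet E → φ (E.indicator w) = ∫ x in E, h x ∂μ := by
  classical
  let ν : SignedMeasure Ω :=
    { measureOf' := fun E => if MeasurableSet E then φ (E.indicator w) else 0
      empty' := by
        rw [if_pos MeasurableSet.empty, indicator_empty]
        exact hφ.map_zero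
      not_measurable' := fun E hE => if_neg hE
      m_iUnion' := fun E hE hd => by
        simpa only [if_pos (hE _), if_pos (MeasurableSet.iUnion hE)] using
          hφ.hasSum_indicator hX hw hE hd }
  have hν : ∀ E, MeasurableSet E → ν E = φ (E.indicator w) := fun E hE => if_pos hE
  have hac : ν ≪ᵥ μ.toENNRealVectorMeasure := by
    refine VectorMeasure.AbsolutelyContinuous.mk fun E hE h0 => ?_
    rw [Measure.toENNRealVectorMeasure_apply_measurable hE] at h0
    rw [hν E hE]
    exact hφ.map_eq_zero (QBFS.indicator_mem hw hE) (indicator_meas_zero h0)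
  refine ⟨ν.rnDeriv μ, SignedMeasure.measurable_rnDeriv ν μ, SignedMeasure.integrable_rnDeriv ν μ,
    fun E hE => ?_⟩
  rw [← hν E hE, ← withDensityᵥ_apply (SignedMeasure.integrable_rnDeriv ν μ) hE,
    SignedMeasure.withDensityᵥ_rnDeriv_eq ν μ hac]

lemma QBFS.simpleFunc_mul_mem {w : Ω → ℝ} (hw : w ∈ X.carrier) (s : SimpleFunc Ω ℝ) :
    (fun x => s x * w x) ∈ X.carrier := by
  obtain ⟨C, hC⟩ := s.exists_forall_norm_le
  refine (X.ideal _ (X.smul_mem C w hw) _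
    (s.measurable.aemeasurable.mul (X.aemeasurable_mem w hw)) (ae_of_all _ fun x => ?_)).1
  rw [Pi.mul_apply, Pi.smul_apply, smul_eq_mul, abs_mul, abs_mul]
  exact mul_le_mul_of_nonneg_right ((hC x).trans (le_abs_self C)) (abs_nonneg _)

lemma integrable_simpleFunc_mul {h : Ω → ℝ} (hh : Integrable h μ) (s : SimpleFunc Ω ℝ) :
    Integrable (fun x => s x * h x) μ := by
  obtain ⟨C, hC⟩ := s.exists_forall_norm_le
  exact hh.bdd_mul s.measurable.aestronglyMeasurable (ae_of_all _ hC)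

lemma IsBddLinFunctional.map_simpleFunc_mul (hφ : IsBddLinFunctional X φ) {w h : Ω → ℝ}
    (hw : w ∈ X.carrier) (hh : Integrable h μ)
    (hwh : ∀ E, MeasurableSet E → φ (E.indicator w) = ∫ x in E, h x ∂μ) (s : SimpleFunc Ω ℝ) :
    φ (fun x => s x * w x) = ∫ x, s x * h x ∂μ := by
  induction s using SimpleFunc.induction with
  | const c hE =>
    rename_i E
    have h1 : ∀ k : Ω → ℝ, (fun x => (SimpleFunc.piecewise E hE (SimpleFunc.const Ω c)
        (SimpleFunc.const Ω 0)) x * k x) = c • E.indicator k := fun k => by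
      ext x
      by_cases hx : x ∈ E <;> simp [hx]
    rw [h1, h1, hφ.2.1 c _ (QBFS.indicator_mem hw hE), hwh E hE, ← integral_indicator hE]
    exact (integral_const_mul c _).symm
  | add _ hs ht =>
    rename_i s t _
    have h1 : (fun x => (s + t) x * w x) = (fun x => s x * w x) + fun x => t x * w x := by
      ext x
      simp [add_mul]
    rw [h1, hφ.1 _ (QBFS.simpleFunc_mul_mem hw s) _ (QBFS.simpleFunc_mul_mem hw t), hs, ht,
      ← integral_add (integrable_simpleFunc_mul hh s) (integrable_simpleFunc_mul hh t)]
    simp [add_mul]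

/-- Bounded functionals on an order-continuous Banach function space are given by elements of the
Köthe dual. -/
theorem IsBddLinFunctional.exists_kotheDual [SigmaFinite μ] (hφ : IsBddLinFunctional X φ)
    (hB : X.IsBanach) (hX : X.OrderContinuous) :
    ∃ g ∈ X.kotheDual, ∀ f ∈ X.carrier, φ f = ∫ x, f x * g x ∂μ := by
  obtain ⟨w, hw, hwm, hw0⟩ := QBFS.exists_weakUnit hB
  obtain ⟨h, hhm, hh, hwh⟩ := hφ.exists_density hX hw
  obtain ⟨C, hC0, hC⟩ := hφ.2.2
  have key : ∀ f ∈ X.carrier, Measurable f →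
      Integrable (fun x => f x * (h x / w x)) μ ∧ φ f = ∫ x, f x * (h x / w x) ∂μ := by
    intro f hf hfm
    have hqm : Measurable fun x => f x / w x := hfm.div hwm
    set s : ℕ → SimpleFunc Ω ℝ := fun n => SimpleFunc.approxOn _ hqm univ 0 (mem_univ _) n
    have hslim : ∀ x, Tendsto (fun n => s n x) atTop (𝓝 (f x / w x)) := fun x =>
      SimpleFunc.tendsto_approxOn hqm (mem_univ _) (by simp)
    have hsle : ∀ n x, |s n x| ≤ 2 * |f x / w x| := fun n x => by
      have := SimpleFunc.norm_approxOn_zero_le hqm (mem_univ _) x n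
      rw [← two_mul] at this
      exact this
    have hsw : ∀ n x, |s n x * w x| ≤ 2 * |f x| := fun n x => by
      have := mul_le_mul_of_nonneg_right (hsle n x) (hw0 x).le
      rwa [abs_div, abs_of_pos (hw0 x), mul_assoc, div_mul_cancel₀ _ (hw0 x).ne',
        ← abs_of_pos (hw0 x), ← abs_mul] at this
    have hF : (fun x => 2 * |f x|) ∈ X.carrier := X.smul_mem 2 _ (QBFS.abs_mem hf)
    have hprod : ∀ x, Tendsto (fun n => s n x * h x) atTop (𝓝 (f x * (h x / w x))) := fun x => by
      have := (hslim x).mul_const (h x)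
      rwa [show f x / w x * h x = f x * (h x / w x) by ring] at this
    have hgm : AEStronglyMeasurable (fun x => f x * (h x / w x)) μ :=
      (hfm.mul (hhm.div hwm)).aestronglyMeasurable
    have hint : Integrable (fun x => f x * (h x / w x)) μ := by
      have hpos : MeasurableSet {x | 0 ≤ h x} := measurableSet_le measurable_const hhm
      set σ : SimpleFunc Ω ℝ := SimpleFunc.piecewise _ hpos (SimpleFunc.const Ω 1)
        (SimpleFunc.const Ω (-1))
      have hσ : ∀ x, σ x * h x = |h x| := fun x => by
        by_cases hx : 0 ≤ h x
        · simp [σ, hx, abs_of_nonneg hx]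
        · simp [σ, hx, abs_of_neg (not_le.1 hx)]
      have hσ1 : ∀ x, |σ x| = 1 := fun x => by
        by_cases hx : 0 ≤ h x <;> simp [σ, hx]
      have hbound : ∀ n, ∫⁻ x, ‖s n x * h x‖ₑ ∂μ ≤
          ENNReal.ofReal (C * X.qnorm (fun x => 2 * |f x|)) := by
        intro n
        set t : SimpleFunc Ω ℝ := (s n).map (fun y => |y|) * σ
        have ht : ∀ x, t x * h x = ‖s n x * h x‖ := fun x => by
          simp [t, mul_assoc, hσ]
        have hti : Integrable (fun x => ‖s n x * h x‖) μ := (integrable_simpleFunc_mul hh _).norm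
        have htw : X.qnorm (fun x => t x * w x) ≤ X.qnorm (fun x => 2 * |f x|) := by
          have hmem := QBFS.simpleFunc_mul_mem hw t
          refine (X.ideal _ hF _ (X.aemeasurable_mem _ hmem) (ae_of_all _ fun x => ?_)).2
          have := hsw n x
          rw [abs_mul] at this
          simpa [t, abs_mul, hσ1] using this
        simp_rw [← ofReal_norm]
        rw [← ofReal_integral_eq_lintegral_ofReal hti (ae_of_all _ fun x => norm_nonneg _)]
        refine ENNReal.ofReal_le_ofReal ?_
        rw [← integral_congr_ae (ae_of_all μ ht), ← hφ.map_simpleFunc_mul hw hh hwh]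
        exact (le_abs_self _).trans ((hC _ (QBFS.simpleFunc_mul_mem hw t)).trans
          (mul_le_mul_of_nonneg_left htw hC0))
      refine ⟨hgm, lt_of_le_of_lt ?_ (ENNReal.ofReal_lt_top
        (r := C * X.qnorm (fun x => 2 * |f x|)))⟩
      calc ∫⁻ x, ‖f x * (h x / w x)‖ₑ ∂μ
          = ∫⁻ x, liminf (fun n => ‖s n x * h x‖ₑ) atTop ∂μ :=
            lintegral_congr fun x => ((hprod x).enorm.liminf_eq).symm
        _ ≤ liminf (fun n => ∫⁻ x, ‖s n x * h x‖ₑ ∂μ) atTop :=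
            lintegral_liminf_le fun n => ((s n).measurable.mul hhm).enorm
        _ ≤ _ := liminf_le_of_le (by isBoundedDefault) fun b hb => by
            obtain ⟨n, hn⟩ := hb.exists
            exact hn.trans (hbound n)
    refine ⟨hint, ?_⟩
    have hlim1 : Tendsto (fun n => φ (fun x => s n x * w x)) atTop (𝓝 (φ f)) := by
      refine hφ.tendsto (fun n => QBFS.simpleFunc_mul_mem hw (s n)) hf
        (hX.tendsto_qnorm_sub (fun n => X.aemeasurable_mem _ (QBFS.simpleFunc_mul_mem hw (s n)))
          hfm.aemeasurable hF (fun n => ae_of_all _ (hsw n)) (ae_of_all _ fun x => ?_))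
      have := (hslim x).mul_const (w x)
      rwa [div_mul_cancel₀ _ (hw0 x).ne'] at this
    have hlim2 : Tendsto (fun n => ∫ x, s n x * h x ∂μ) atTop
        (𝓝 (∫ x, f x * (h x / w x) ∂μ)) := by
      refine tendsto_integral_of_dominated_convergence (fun x => 2 * ‖f x * (h x / w x)‖)
        (fun n => ((s n).measurable.mul hhm).aestronglyMeasurable) (hint.norm.const_mul 2)
        (fun n => ae_of_all _ fun x => ?_) (ae_of_all _ hprod)
      have := mul_le_mul_of_nonneg_right (hsle n x) (abs_nonneg (h x))
      rw [← abs_mul, mul_assoc, ← abs_mul] at this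
      rwa [show f x * (h x / w x) = f x / w x * h x by ring]
    refine tendsto_nhds_unique hlim1 ?_
    simpa only [hφ.map_simpleFunc_mul hw hh hwh] using hlim2
  have key' : ∀ f ∈ X.carrier,
      Integrable (fun x => f x * (h x / w x)) μ ∧ φ f = ∫ x, f x * (h x / w x) ∂μ := by
    intro f hf
    have hfm := X.aemeasurable_mem f hf
    have hae : (fun x => hfm.mk f x * (h x / w x)) =ᵐ[μ] fun x => f x * (h x / w x) :=
      hfm.ae_eq_mk.mono fun x hx => by simp only [hx]
    obtain ⟨h1, h2⟩ := key _ (QBFS.mem_congr hf hfm.ae_eq_mk) hfm.measurable_mk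
    exact ⟨h1.congr hae, by rw [hφ.map_congr hf hfm.ae_eq_mk, h2, integral_congr_ae hae]⟩
  exact ⟨fun x => h x / w x, ⟨(hhm.div hwm).aemeasurable, fun f hf => (key' f hf).1⟩,
    fun f hf => (key' f hf).2⟩

end Functionals

namespace QBFS

section KotheDual

variable {X : QBFS μ} {f g : Ω → ℝ}

lemma integrable_abs_mul (hg : g ∈ X.kotheDual) (hf : f ∈ X.carrier) :
    Integrable (fun x => |f x * g x|) μ :=
  (hg.2 f hf).abs

lemma integral_abs_smul_mul (c : ℝ) (f g : Ω → ℝ) :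
    ∫ x, |(c • f) x * g x| ∂μ = |c| * ∫ x, |f x * g x| ∂μ := by
  rw [← integral_const_mul]
  exact integral_congr_ae (ae_of_all _ fun x => by simp [abs_mul, mul_assoc])

lemma integral_abs_mul_eq_zero (h : f =ᵐ[μ] 0) (g : Ω → ℝ) : ∫ x, |f x * g x| ∂μ = 0 :=
  integral_eq_zero_of_ae (h.mono fun x hx => by simp [hx])

/-- Integration against an element of the Köthe dual is bounded. -/
lemma exists_forall_integral_abs_mul_le (hB : X.IsBanach) (hg : g ∈ X.kotheDual) :
    ∃ C : ℝ, 0 ≤ C ∧ ∀ f ∈ X.carrier, ∫ x, |f x * g x| ∂μ ≤ C * X.qnorm f := by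
  by_contra! hcon
  choose f hf hlt using fun n : ℕ => hcon (4 ^ n) (by positivity)
  have hpos : ∀ n, 0 < X.qnorm (f n) := fun n => by
    refine (X.qnorm_nonneg _ (hf n)).lt_of_ne' fun h0 => ?_
    have := hlt n
    rw [integral_abs_mul_eq_zero ((X.qnorm_eq_zero_iff _ (hf n)).1 h0), h0, mul_zero] at this
    exact this.false
  set c : ℕ → ℝ := fun n => (1 / 2) ^ n / X.qnorm (f n)
  have hc : ∀ n, 0 < c n := fun n => div_pos (by positivity) (hpos n)
  obtain ⟨F, hF, hle⟩ := exists_dominating hB (u := fun n => c n • f n)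
    (fun n => X.smul_mem _ _ (hf n)) (by
      refine (summable_geometric_of_lt_one (by norm_num) (by norm_num : (1 / 2 : ℝ) < 1)).congr
        fun n => ?_
      rw [X.qnorm_smul _ _ (hf n), abs_of_pos (hc n), div_mul_cancel₀ _ (hpos n).ne'])
  have hbig : ∀ n : ℕ, (2 : ℝ) ^ n ≤ ∫ x, |F x * g x| ∂μ := fun n => by
    calc (2 : ℝ) ^ n = c n * (4 ^ n * X.qnorm (f n)) := by
          have : c n * (4 ^ n * X.qnorm (f n)) = (1 / 2 * 4) ^ n := by
            rw [mul_pow, show c n * (4 ^ n * X.qnorm (f n)) = c n * X.qnorm (f n) * 4 ^ n by ring,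
              div_mul_cancel₀ _ (hpos n).ne']
          rw [this]
          norm_num
      _ ≤ c n * ∫ x, |f n x * g x| ∂μ := mul_le_mul_of_nonneg_left (hlt n).le (hc n).le
      _ = ∫ x, |(c n • f n) x * g x| ∂μ := by rw [integral_abs_smul_mul, abs_of_pos (hc n)]
      _ ≤ ∫ x, |F x * g x| ∂μ := by
          refine integral_mono_ae (integrable_abs_mul hg (X.smul_mem _ _ (hf n)))
            (integrable_abs_mul hg hF) ((hle n).mono fun x hx => ?_)
          simp only [abs_mul (F x), abs_mul ((c n • f n) x)]
          exact mul_le_mul_of_nonneg_right (hx.trans (le_abs_self _)) (abs_nonneg _)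
  obtain ⟨n, hn⟩ := pow_unbounded_of_one_lt (∫ x, |F x * g x| ∂μ) (by norm_num : (1 : ℝ) < 2)
  exact (hn.trans_le (hbig n)).false

lemma dualNorm_nonneg (X : QBFS μ) (g : Ω → ℝ) : 0 ≤ X.dualNorm g :=
  Real.sSup_nonneg (by rintro _ ⟨f, -, rfl⟩; exact integral_nonneg fun x => abs_nonneg _)

/-- Hölder's inequality. -/
lemma integral_abs_mul_le (hB : X.IsBanach) (hg : g ∈ X.kotheDual) (hf : f ∈ X.carrier) :
    ∫ x, |f x * g x| ∂μ ≤ X.dualNorm g * X.qnorm f := by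
  obtain ⟨C, -, hC⟩ := exists_forall_integral_abs_mul_le hB hg
  rcases (X.qnorm_nonneg f hf).eq_or_lt with h0 | hpos
  · rw [integral_abs_mul_eq_zero ((X.qnorm_eq_zero_iff f hf).1 h0.symm), ← h0, mul_zero]
  · have hmem : ((X.qnorm f)⁻¹ • f) ∈ X.carrier := X.smul_mem _ _ hf
    have hone : X.qnorm ((X.qnorm f)⁻¹ • f) = 1 := by
      rw [X.qnorm_smul _ _ hf, abs_of_pos (inv_pos.2 hpos), inv_mul_cancel₀ hpos.ne']
    have hle : ∫ x, |((X.qnorm f)⁻¹ • f) x * g x| ∂μ ≤ X.dualNorm g := by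
      refine le_csSup ⟨C, ?_⟩ ⟨_, ⟨hmem, hone⟩, rfl⟩
      rintro _ ⟨u, ⟨hu, hu1⟩, rfl⟩
      simpa [hu1] using hC u hu
    rw [integral_abs_smul_mul, abs_of_pos (inv_pos.2 hpos), inv_mul_le_iff₀ hpos] at hle
    linarith

lemma abs_integral_mul_le (hB : X.IsBanach) (hg : g ∈ X.kotheDual) (hf : f ∈ X.carrier) :
    |∫ x, f x * g x ∂μ| ≤ X.dualNorm g * X.qnorm f :=
  abs_integral_le_integral_abs.trans (integral_abs_mul_le hB hg hf)

/-- The Köthe dual norm is at most any operator bound of the functional `f ↦ ∫ f g`. -/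
lemma dualNorm_le {C : ℝ} (hC : 0 ≤ C) (hgm : AEMeasurable g μ)
    (h : ∀ f ∈ X.carrier, |∫ x, f x * g x ∂μ| ≤ C * X.qnorm f) : X.dualNorm g ≤ C := by
  refine Real.sSup_le ?_ hC
  rintro _ ⟨f, ⟨hf, hf1⟩, rfl⟩
  have hfm := X.aemeasurable_mem f hf
  set σ : ℝ → ℝ := fun y => if 0 ≤ y then 1 else -1
  have hσm : Measurable σ := Measurable.ite measurableSet_Ici measurable_const measurable_const
  have hσ : ∀ y, σ y * y = |y| ∧ |σ y| = 1 := fun y => by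
    by_cases hy : 0 ≤ y
    · simp [σ, hy, abs_of_nonneg hy]
    · simp [σ, hy, abs_of_neg (not_le.1 hy)]
  obtain ⟨hmem, hle⟩ := X.ideal f hf (fun x => σ (f x * g x) * f x)
    ((hσm.comp_aemeasurable (hfm.mul hgm)).mul hfm) (ae_of_all _ fun x => by
      rw [abs_mul, (hσ _).2, one_mul])
  calc ∫ x, |f x * g x| ∂μ
      = ∫ x, σ (f x * g x) * f x * g x ∂μ :=
        integral_congr_ae (ae_of_all _ fun x => by
          simp only [mul_assoc]
          exact (hσ _).1.symm)
    _ ≤ C * X.qnorm _ := (le_abs_self _).trans (h _ hmem)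
    _ ≤ C * X.qnorm f := mul_le_mul_of_nonneg_left hle hC
    _ = C := by rw [hf1, mul_one]

lemma isBddLinFunctional_integral (hB : X.IsBanach) (hg : g ∈ X.kotheDual) :
    IsBddLinFunctional X fun f => ∫ x, f x * g x ∂μ := by
  refine ⟨fun f hf u hu => ?_, fun c f hf => ?_, X.dualNorm g, dualNorm_nonneg X g,
    fun f hf => abs_integral_mul_le hB hg hf⟩
  · rw [← integral_add (hg.2 f hf) (hg.2 u hu)]
    simp [add_mul]
  · rw [← integral_const_mul]
    simp [mul_assoc]

lemma opNorm_integral_le (hB : X.IsBanach) (hg : g ∈ X.kotheDual) :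
    opNorm X (fun f => ∫ x, f x * g x ∂μ) ≤ X.dualNorm g :=
  csInf_le ⟨0, fun _ hC => hC.1⟩ ⟨dualNorm_nonneg X g, fun _ hf => abs_integral_mul_le hB hg hf⟩

lemma kotheDual_add (hf : f ∈ X.kotheDual) (hg : g ∈ X.kotheDual) : f + g ∈ X.kotheDual :=
  ⟨hf.1.add hg.1, fun u hu => by
    simpa only [Pi.add_apply, mul_add] using! (hf.2 u hu).add (hg.2 u hu)⟩

lemma kotheDual_smul (c : ℝ) (hg : g ∈ X.kotheDual) : c • g ∈ X.kotheDual :=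
  ⟨hg.1.const_smul c, fun u hu => by
    simpa [mul_left_comm] using (hg.2 u hu).const_mul c⟩

lemma kotheDual_sub (hf : f ∈ X.kotheDual) (hg : g ∈ X.kotheDual) : f - g ∈ X.kotheDual :=
  ⟨hf.1.sub hg.1, fun u hu => by
    simpa only [Pi.sub_apply, mul_sub] using! (hf.2 u hu).sub (hg.2 u hu)⟩

lemma kotheDual_ideal (hg : g ∈ X.kotheDual) (hfm : AEMeasurable f μ)
    (h : ∀ᵐ x ∂μ, |f x| ≤ |g x|) : f ∈ X.kotheDual :=
  ⟨hfm, fun u hu => (hg.2 u hu).mono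
    ((X.aemeasurable_mem u hu).mul hfm).aestronglyMeasurable (h.mono fun x hx => by
      simp only [Real.norm_eq_abs, abs_mul]
      exact mul_le_mul_of_nonneg_left hx (abs_nonneg _))⟩

lemma dualNorm_add_le (hB : X.IsBanach) (hf : f ∈ X.kotheDual) (hg : g ∈ X.kotheDual) :
    X.dualNorm (f + g) ≤ X.dualNorm f + X.dualNorm g := by
  refine dualNorm_le (add_nonneg (dualNorm_nonneg X f) (dualNorm_nonneg X g))
    (hf.1.add hg.1) fun u hu => ?_
  have : ∫ x, u x * (f + g) x ∂μ = ∫ x, u x * f x ∂μ + ∫ x, u x * g x ∂μ := by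
    rw [← integral_add (hf.2 u hu) (hg.2 u hu)]
    simp [mul_add]
  rw [this, add_mul]
  exact (abs_add_le _ _).trans
    (add_le_add (abs_integral_mul_le hB hf hu) (abs_integral_mul_le hB hg hu))

lemma dualNorm_smul (c : ℝ) (g : Ω → ℝ) : X.dualNorm (c • g) = |c| * X.dualNorm g := by
  have : ∀ f : Ω → ℝ, ∫ x, |f x * (c • g) x| ∂μ = |c| * ∫ x, |f x * g x| ∂μ := fun f => by
    rw [← integral_abs_smul_mul]
    exact integral_congr_ae (ae_of_all _ fun x => by simp [mul_left_comm, mul_assoc])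
  simp only [dualNorm, this]
  rw [← smul_eq_mul, ← Real.sSup_smul_of_nonneg (abs_nonneg c), ← image_smul, image_image]
  simp only [smul_eq_mul]

lemma dualNorm_mono (hB : X.IsBanach) (hg : g ∈ X.kotheDual) (hfm : AEMeasurable f μ)
    (h : ∀ᵐ x ∂μ, |f x| ≤ |g x|) : X.dualNorm f ≤ X.dualNorm g := by
  have hf := kotheDual_ideal hg hfm h
  refine dualNorm_le (dualNorm_nonneg X g) hfm fun u hu => ?_
  refine abs_integral_le_integral_abs.trans
    (le_trans ?_ (integral_abs_mul_le hB hg hu))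
  refine integral_mono_ae (hf.2 u hu).abs (hg.2 u hu).abs (h.mono fun x hx => ?_)
  simp only [abs_mul]
  exact mul_le_mul_of_nonneg_left hx (abs_nonneg _)

lemma dualNorm_eq_zero_iff [SigmaFinite μ] (hB : X.IsBanach) (hg : g ∈ X.kotheDual) :
    X.dualNorm g = 0 ↔ g =ᵐ[μ] 0 := by
  refine ⟨fun h0 => ?_, fun h0 => ?_⟩
  · obtain ⟨w, hw, -, hwpos⟩ := exists_weakUnit hB
    have h1 : ∫ x, |w x * g x| ∂μ = 0 := by
      refine le_antisymm ?_ (integral_nonneg fun x => abs_nonneg _)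
      simpa [h0] using integral_abs_mul_le hB hg hw
    have h2 := (integral_eq_zero_iff_of_nonneg (fun x => abs_nonneg _)
      (integrable_abs_mul hg hw)).1 h1
    filter_upwards [h2] with x hx
    simpa [(hwpos x).ne'] using hx
  · refine le_antisymm (dualNorm_le le_rfl hg.1 fun u hu => ?_) (dualNorm_nonneg X g)
    rw [integral_eq_zero_of_ae (h0.mono fun x hx => by simp [hx])]
    simp

end KotheDual

/-- The elements of `X`, as a vector subspace of `Ω → ℝ`. -/
def toSubmodule (X : QBFS μ) : Submodule ℝ (Ω → ℝ) where
  carrier := X.carrier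
  add_mem' := fun hf hg => X.add_mem _ hf _ hg
  zero_mem' := X.zero_mem
  smul_mem' := X.smul_mem

/-- A Banach function space as a seminormed space. -/
def Space (X : QBFS μ) (_hB : X.IsBanach) : Type _ := X.toSubmodule

namespace Space

variable {X : QBFS μ} {hB : X.IsBanach}

noncomputable instance : AddCommGroup (X.Space hB) := inferInstanceAs (AddCommGroup X.toSubmodule)

noncomputable instance : Module ℝ (X.Space hB) := inferInstanceAs (Module ℝ X.toSubmodule)

noncomputable instance : Norm (X.Space hB) := ⟨fun f => X.qnorm f.1⟩

lemma seminormedCore : SeminormedSpace.Core ℝ (X.Space hB) where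
  norm_nonneg f := X.qnorm_nonneg f.1 f.2
  norm_smul c f := X.qnorm_smul c f.1 f.2
  norm_triangle f g := hB f.1 f.2 g.1 g.2

noncomputable instance : SeminormedAddCommGroup (X.Space hB) :=
  SeminormedAddCommGroup.ofCore seminormedCore

noncomputable instance : NormedSpace ℝ (X.Space hB) where
  norm_smul_le c f := (X.qnorm_smul c f.1 f.2).le

/-- A bounded functional in the pointwise sense, as an element of the strong dual. -/
noncomputable def toDual (hB : X.IsBanach) {φ : (Ω → ℝ) → ℝ} (hφ : IsBddLinFunctional X φ) :
    StrongDual ℝ (X.Space hB) :=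
  LinearMap.mkContinuousOfExistsBound
    { toFun := fun f => φ f.1
      map_add' := fun f g => hφ.1 f.1 f.2 g.1 g.2
      map_smul' := fun c f => hφ.2.1 c f.1 f.2 }
    (let ⟨C, _, hC⟩ := hφ.2.2; ⟨C, fun f => hC f.1 f.2⟩)

open Classical in
/-- An element of the strong dual as a function on `Ω → ℝ`, extended by zero outside `X`. -/
noncomputable def ofDual (φ : StrongDual ℝ (X.Space hB)) : (Ω → ℝ) → ℝ :=
  fun f => if hf : f ∈ X.carrier then φ ⟨f, hf⟩ else 0

lemma ofDual_apply (φ : StrongDual ℝ (X.Space hB)) {f : Ω → ℝ} (hf : f ∈ X.carrier) :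
    ofDual φ f = φ ⟨f, hf⟩ := dif_pos hf

lemma abs_ofDual_le (φ : StrongDual ℝ (X.Space hB)) {f : Ω → ℝ} (hf : f ∈ X.carrier) :
    |ofDual φ f| ≤ ‖φ‖ * X.qnorm f := by
  rw [ofDual_apply φ hf]
  exact φ.le_opNorm ⟨f, hf⟩

lemma isBddLinFunctional_ofDual (φ : StrongDual ℝ (X.Space hB)) :
    IsBddLinFunctional X (ofDual φ) := by
  refine ⟨fun f hf g hg => ?_, fun c f hf => ?_, ‖φ‖, norm_nonneg _,
    fun f hf => abs_ofDual_le φ hf⟩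
  · rw [ofDual_apply φ hf, ofDual_apply φ hg, ofDual_apply φ (X.add_mem f hf g hg)]
    exact φ.map_add ⟨f, hf⟩ ⟨g, hg⟩
  · rw [ofDual_apply φ hf, ofDual_apply φ (X.smul_mem c f hf)]
    exact φ.map_smul c ⟨f, hf⟩

end Space

/-- Hahn–Banach: every element is normed by a functional of norm at most one. -/
lemma exists_norming {X : QBFS μ} (hB : X.IsBanach) {f : Ω → ℝ} (hf : f ∈ X.carrier) :
    ∃ φ, IsBddLinFunctional X φ ∧ (∀ u ∈ X.carrier, |φ u| ≤ X.qnorm u) ∧ φ f = X.qnorm f := by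
  obtain ⟨φ, hφ1, hφf⟩ := exists_dual_vector'' ℝ (E := X.Space hB) ⟨f, hf⟩
  refine ⟨Space.ofDual φ, Space.isBddLinFunctional_ofDual φ, fun u hu => ?_, ?_⟩
  · exact (Space.abs_ofDual_le φ hu).trans
      (mul_le_of_le_one_left (X.qnorm_nonneg u hu) hφ1)
  · rw [Space.ofDual_apply φ hf, hφf]
    rfl

end QBFS

section DualSpace

variable {X : QBFS μ} {φ ψ : (Ω → ℝ) → ℝ}

/-- The Köthe dual of an order-continuous Banach function space as a function space. -/
noncomputable def QBFS.kotheSpace [SigmaFinite μ] (X : QBFS μ) (hB : X.IsBanach)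
    (hX : X.OrderContinuous) : QBFS μ where
  carrier := X.kotheDual
  qnorm := X.dualNorm
  K := 1
  one_le_K := le_rfl
  aemeasurable_mem g hg := hg.1
  zero_mem := ⟨aemeasurable_zero, fun f _ => by simp⟩
  add_mem f hf g hg := QBFS.kotheDual_add hf hg
  smul_mem c g hg := QBFS.kotheDual_smul c hg
  qnorm_nonneg g _ := QBFS.dualNorm_nonneg X g
  qnorm_eq_zero_iff g hg := QBFS.dualNorm_eq_zero_iff hB hg
  qnorm_smul c g _ := QBFS.dualNorm_smul c g
  qnorm_triangle f hf g hg := by simpa using QBFS.dualNorm_add_le hB hf hg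
  ideal g hg f hfm h := ⟨QBFS.kotheDual_ideal hg hfm h, QBFS.dualNorm_mono hB hg hfm h⟩
  saturated E hE hpos := by
    obtain ⟨F, hFE, hF, hFpos, hFX⟩ := X.saturated E hE hpos
    obtain ⟨φ, hφ, -, hφF⟩ := QBFS.exists_norming hB hFX
    obtain ⟨g, hg, hrep⟩ := hφ.exists_kotheDual hB hX
    have hgm : Measurable (hg.1.mk g) := hg.1.measurable_mk
    have hgg : g =ᵐ[μ] hg.1.mk g := hg.1.ae_eq_mk
    set G : ℕ → Set Ω := fun n => F ∩ {x | 1 / ((n : ℝ) + 1) < |hg.1.mk g x|}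
    have hG : ∀ n, MeasurableSet (G n) := fun n =>
      hF.inter (measurableSet_lt measurable_const hgm.abs)
    have hex : ∃ n, μ (G n) ≠ 0 := by
      by_contra! hall
      have hnot : ∀ᵐ x ∂μ, ∀ n, x ∉ G n :=
        ae_all_iff.2 fun n => measure_eq_zero_iff_ae_notMem.1 (hall n)
      have hzero : φ (F.indicator fun _ => (1 : ℝ)) = 0 := by
        rw [hrep _ hFX]
        refine integral_eq_zero_of_ae ?_
        filter_upwards [hnot, hgg] with x hx hx'
        by_cases hxF : x ∈ F
        · have h0 : hg.1.mk g x = 0 := by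
            by_contra hne
            obtain ⟨n, hn⟩ := exists_nat_one_div_lt (abs_pos.2 hne)
            exact hx n ⟨hxF, hn⟩
          simp [hx', h0]
        · simp [hxF]
      rw [hφF, X.qnorm_eq_zero_iff _ hFX] at hzero
      refine hFpos.ne' (measure_eq_zero_iff_ae_notMem.2 ?_)
      filter_upwards [hzero] with x hx hxF
      simp [hxF] at hx
    obtain ⟨n, hn⟩ := hex
    refine ⟨G n, inter_subset_left.trans hFE, hG n, pos_iff_ne_zero.2 hn, ?_⟩
    refine QBFS.kotheDual_ideal (QBFS.kotheDual_smul ((n : ℝ) + 1) hg)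
      (aemeasurable_const.indicator (hG n)) ?_
    filter_upwards [hgg] with x hx
    by_cases hxG : x ∈ G n
    · have h1 : 1 / ((n : ℝ) + 1) < |g x| := by rw [hx]; exact hxG.2
      have h2 : (0 : ℝ) < n + 1 := by positivity
      rw [div_lt_iff₀ h2] at h1
      simp only [indicator_of_mem hxG, abs_one, Pi.smul_apply, smul_eq_mul, abs_mul,
        abs_of_pos h2]
      linarith
    · rw [indicator_of_notMem hxG, abs_zero]
      exact abs_nonneg _
  complete g hg hC := by
    set ψ : ℕ → StrongDual ℝ (X.Space hB) := fun n =>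
      QBFS.Space.toDual hB (QBFS.isBddLinFunctional_integral hB (hg n))
    have hsub : ∀ {u v f : Ω → ℝ}, u ∈ X.kotheDual → v ∈ X.kotheDual → f ∈ X.carrier →
        ∫ x, f x * (u - v) x ∂μ = ∫ x, f x * u x ∂μ - ∫ x, f x * v x ∂μ := fun hu hv hf => by
      rw [← integral_sub (hu.2 _ hf) (hv.2 _ hf)]
      simp [mul_sub]
    have hψC : CauchySeq ψ := by
      refine Metric.cauchySeq_iff.2 fun ε hε => ?_
      obtain ⟨N, hN⟩ := hC ε hε
      refine ⟨N, fun j hj k hk => lt_of_le_of_lt ?_ (hN j hj k hk)⟩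
      rw [dist_eq_norm]
      refine ContinuousLinearMap.opNorm_le_bound _ (QBFS.dualNorm_nonneg X _) fun f => ?_
      have := QBFS.abs_integral_mul_le hB (QBFS.kotheDual_sub (hg j) (hg k)) f.2
      rwa [hsub (hg j) (hg k) f.2] at this
    obtain ⟨ψ', hψ'⟩ := cauchySeq_tendsto_of_complete hψC
    obtain ⟨g', hg', hrep⟩ :=
      (QBFS.Space.isBddLinFunctional_ofDual ψ').exists_kotheDual hB hX
    refine ⟨g', hg', squeeze_zero (fun n => QBFS.dualNorm_nonneg X _) (fun n => ?_)
      (tendsto_iff_norm_sub_tendsto_zero.1 hψ')⟩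
    refine QBFS.dualNorm_le (norm_nonneg _) ((hg n).1.sub hg'.1) fun f hf => ?_
    rw [hsub (hg n) hg' hf, ← hrep f hf, QBFS.Space.ofDual_apply ψ' hf]
    exact (ψ n - ψ').le_opNorm ⟨f, hf⟩

lemma IsBddLinFunctional.abs_le_opNorm (hφ : IsBddLinFunctional X φ) {f : Ω → ℝ}
    (hf : f ∈ X.carrier) : |φ f| ≤ opNorm X φ * X.qnorm f := by
  obtain ⟨C, hC0, hC⟩ := hφ.2.2
  rcases (X.qnorm_nonneg f hf).eq_or_lt with h0 | hpos
  · simpa [← h0] using hC f hf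
  · rw [← div_le_iff₀ hpos]
    exact le_csInf ⟨C, hC0, hC⟩ fun D hD => (div_le_iff₀ hpos).2 (hD.2 f hf)

lemma opNorm_nonneg (X : QBFS μ) (φ : (Ω → ℝ) → ℝ) : 0 ≤ opNorm X φ :=
  Real.sInf_nonneg fun _ hC => hC.1

lemma IsBddLinFunctional.add (hφ : IsBddLinFunctional X φ) (hψ : IsBddLinFunctional X ψ) :
    IsBddLinFunctional X (φ + ψ) := by
  obtain ⟨C, hC0, hC⟩ := hφ.2.2
  obtain ⟨D, hD0, hD⟩ := hψ.2.2
  refine ⟨fun f hf g hg => ?_, fun c f hf => ?_, C + D, add_nonneg hC0 hD0, fun f hf => ?_⟩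
  · simp only [Pi.add_apply, hφ.1 f hf g hg, hψ.1 f hf g hg]
    ring
  · simp only [Pi.add_apply, hφ.2.1 c f hf, hψ.2.1 c f hf]
    ring
  · rw [add_mul]
    exact (abs_add_le _ _).trans (add_le_add (hC f hf) (hD f hf))

lemma IsBddLinFunctional.smul (c : ℝ) (hφ : IsBddLinFunctional X φ) :
    IsBddLinFunctional X (c • φ) := by
  obtain ⟨C, hC0, hC⟩ := hφ.2.2
  refine ⟨fun f hf g hg => ?_, fun a f hf => ?_, |c| * C, by positivity, fun f hf => ?_⟩
  · simp only [Pi.smul_apply, smul_eq_mul, hφ.1 f hf g hg]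
    ring
  · simp only [Pi.smul_apply, smul_eq_mul, hφ.2.1 a f hf]
    ring
  · rw [Pi.smul_apply, smul_eq_mul, abs_mul, mul_assoc]
    exact mul_le_mul_of_nonneg_left (hC f hf) (abs_nonneg c)

/-- Functionals on the dual only see the restriction of a functional to `X`. -/
lemma IsBddLinOnDual.congr {Φ : ((Ω → ℝ) → ℝ) → ℝ} (hΦ : IsBddLinOnDual X Φ)
    (hφ : IsBddLinFunctional X φ) (hψ : IsBddLinFunctional X ψ)
    (h : ∀ f ∈ X.carrier, φ f = ψ f) : Φ φ = Φ ψ := by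
  obtain ⟨C, hC0, hC⟩ := hΦ.2.2
  have hneg := hψ.smul (-1)
  have h0 : opNorm X (φ + (-1 : ℝ) • ψ) = 0 := by
    refine le_antisymm (csInf_le ⟨0, fun _ hD => hD.1⟩ ⟨le_rfl, fun f hf => ?_⟩)
      (opNorm_nonneg X _)
    simp [h f hf]
  have h1 := hC _ (hφ.add hneg)
  rw [h0, mul_zero, abs_nonpos_iff, hΦ.1 _ _ hφ hneg, hΦ.2.1 _ _ hψ] at h1
  linarith

/-- In an order-continuous space with the Fatou property, `X'' ⊆ X`. -/
lemma QBFS.mem_of_mem_kotheDual_kotheSpace [SigmaFinite μ] (hB : X.IsBanach)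
    (hX : X.OrderContinuous) (hF : X.Fatou) {f : Ω → ℝ}
    (hf : f ∈ (X.kotheSpace hB hX).kotheDual) : f ∈ X.carrier := by
  have hY : (X.kotheSpace hB hX).IsBanach := fun _ hu _ hv => QBFS.dualNorm_add_le hB hu hv
  obtain ⟨w, hw, hwm, hw0⟩ := QBFS.exists_weakUnit hB
  set u : ℕ → Ω → ℝ := fun n x => min |f x| (n * w x)
  have hu0 : ∀ n x, 0 ≤ u n x := fun n x =>
    le_min (abs_nonneg _) (mul_nonneg n.cast_nonneg (hw0 x).le)
  have hum : ∀ n, AEMeasurable (u n) μ := fun n =>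
    hf.1.abs.min (hwm.const_mul _).aemeasurable
  have hu : ∀ n, u n ∈ X.carrier := fun n =>
    (X.ideal _ (X.smul_mem n w hw) _ (hum n) (ae_of_all _ fun x => by
      rw [abs_of_nonneg (hu0 n x)]
      exact (min_le_right _ _).trans (le_abs_self _))).1
  have hbound : ∀ n, X.qnorm (u n) ≤ (X.kotheSpace hB hX).dualNorm f := by
    intro n
    obtain ⟨φ, hφ, hφ1, hφu⟩ := QBFS.exists_norming hB (hu n)
    obtain ⟨g, hg, hrep⟩ := hφ.exists_kotheDual hB hX
    have hg1 : X.dualNorm g ≤ 1 := QBFS.dualNorm_le zero_le_one hg.1 fun v hv => by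
      rw [← hrep v hv, one_mul]
      exact hφ1 v hv
    have hgY : g ∈ (X.kotheSpace hB hX).carrier := hg
    calc X.qnorm (u n) = ∫ x, u n x * g x ∂μ := by rw [← hφu, hrep _ (hu n)]
      _ ≤ ∫ x, |g x * f x| ∂μ := by
        refine integral_mono (hg.2 _ (hu n)) (QBFS.integrable_abs_mul hf hgY) fun x => ?_
        refine (le_abs_self _).trans ?_
        rw [abs_mul, abs_mul, mul_comm, abs_of_nonneg (hu0 n x)]
        exact mul_le_mul_of_nonneg_left (min_le_left _ _) (abs_nonneg _)
      _ ≤ (X.kotheSpace hB hX).dualNorm f * X.dualNorm g := QBFS.integral_abs_mul_le hY hf hgY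
      _ ≤ (X.kotheSpace hB hX).dualNorm f :=
        mul_le_of_le_one_right (QBFS.dualNorm_nonneg _ _) hg1
  have habs : (fun x => |f x|) ∈ X.carrier := by
    refine (hF u _ hu hf.1.abs (ae_of_all _ fun x => ⟨hu0 0 x, fun m n hmn => ?_, ?_⟩)
      ⟨_, by rintro _ ⟨n, rfl⟩; exact hbound n⟩).1
    · exact min_le_min_left _
        (mul_le_mul_of_nonneg_right (Nat.cast_le.2 hmn) (hw0 x).le)
    · obtain ⟨N, hN⟩ := exists_nat_ge (|f x| / w x)
      refine tendsto_const_nhds.congr' ?_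
      filter_upwards [eventually_ge_atTop N] with n hn
      refine (min_eq_left ?_).symm
      rw [← div_le_iff₀ (hw0 x)]
      exact hN.trans (Nat.cast_le.2 hn)
  exact (X.ideal _ habs f hf.1 (by simp)).1

theorem isReflexive_of_fatou_of_orderContinuous [SigmaFinite μ] (hB : X.IsBanach)
    (hF : X.Fatou) (hX : X.OrderContinuous) (hX' : DualOrderContinuous X) : IsReflexive X := by
  intro Φ hΦ
  set Y := X.kotheSpace hB hX
  have hY : Y.IsBanach := fun _ hu _ hv => QBFS.dualNorm_add_le hB hu hv
  obtain ⟨C, hC0, hC⟩ := hΦ.2.2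
  have hint := fun {g} (hg : g ∈ X.kotheDual) => QBFS.isBddLinFunctional_integral hB hg
  have hΨ : IsBddLinFunctional Y fun g => Φ fun f => ∫ x, f x * g x ∂μ := by
    refine ⟨fun g hg h hh => ?_, fun c g hg => ?_, C, hC0, fun g hg => ?_⟩
    · rw [← hΦ.1 _ _ (hint hg) (hint hh)]
      refine hΦ.congr (hint (Y.add_mem g hg h hh)) ((hint hg).add (hint hh)) fun f hf => ?_
      simp only [Pi.add_apply]
      rw [← integral_add (hg.2 f hf) (hh.2 f hf)]
      simp [mul_add]
    · rw [← hΦ.2.1 _ _ (hint hg)]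
      refine hΦ.congr (hint (Y.smul_mem c g hg)) ((hint hg).smul c) fun f hf => ?_
      simp only [Pi.smul_apply, smul_eq_mul]
      rw [← integral_const_mul]
      simp [mul_left_comm]
    · exact (hC _ (hint hg)).trans
        (mul_le_mul_of_nonneg_left (QBFS.opNorm_integral_le hB hg) hC0)
  obtain ⟨f, hf, hrep⟩ := hΨ.exists_kotheDual hY hX'
  have hfX := QBFS.mem_of_mem_kotheDual_kotheSpace hB hX hF hf
  refine ⟨f, hfX, fun φ hφ => ?_⟩
  obtain ⟨g, hg, hφg⟩ := hφ.exists_kotheDual hB hX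
  rw [hΦ.congr hφ (hint hg) hφg, hφg f hfX]
  refine (hrep g hg).trans ?_
  simp [mul_comm]

end DualSpace

section Reflexive

variable {X : QBFS μ} {hB : X.IsBanach}

lemma QBFS.Space.norm_toDual_le (hB : X.IsBanach) {φ : (Ω → ℝ) → ℝ}
    (hφ : IsBddLinFunctional X φ) : ‖toDual hB hφ‖ ≤ opNorm X φ :=
  ContinuousLinearMap.opNorm_le_bound _ (opNorm_nonneg X φ) fun f => hφ.abs_le_opNorm f.2

lemma IsReflexive.exists_forall_apply_eq (hR : IsReflexive X)
    (Φ : StrongDual ℝ (StrongDual ℝ (X.Space hB))) :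
    ∃ f : X.Space hB, ∀ ψ, Φ ψ = ψ f := by
  classical
  set Φ' : ((Ω → ℝ) → ℝ) → ℝ := fun φ =>
    if hφ : IsBddLinFunctional X φ then Φ (QBFS.Space.toDual hB hφ) else 0
  have hΦ' : ∀ {φ} (hφ : IsBddLinFunctional X φ), Φ' φ = Φ (QBFS.Space.toDual hB hφ) :=
    fun hφ => dif_pos hφ
  obtain ⟨f, hf, hrep⟩ := hR Φ' ⟨fun φ ψ hφ hψ => by
      rw [hΦ' hφ, hΦ' hψ, hΦ' (hφ.add hψ), ← map_add]
      rfl, fun c φ hφ => by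
      rw [hΦ' hφ, hΦ' (hφ.smul c), ← smul_eq_mul, ← map_smul]
      rfl, ‖Φ‖, Φ.opNorm_nonneg, fun φ hφ => by
      rw [hΦ' hφ]
      exact (Φ.le_opNorm _).trans
        (mul_le_mul_of_nonneg_left (QBFS.Space.norm_toDual_le hB hφ) Φ.opNorm_nonneg)⟩
  refine ⟨⟨f, hf⟩, fun ψ => ?_⟩
  have hψ := QBFS.Space.isBddLinFunctional_ofDual ψ
  have hroundtrip : QBFS.Space.toDual hB hψ = ψ := by
    ext u
    exact QBFS.Space.ofDual_apply ψ u.2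
  rw [← QBFS.Space.ofDual_apply ψ hf, ← hrep _ hψ, hΦ' hψ, hroundtrip]

/-- Bounded sequences in a reflexive space have a weak cluster point; it belongs to every closed
convex set containing a tail of the sequence. -/
lemma IsReflexive.exists_weak_cluster (hR : IsReflexive X) {f : ℕ → X.Space hB} {M : ℝ}
    (hM : ∀ n, ‖f n‖ ≤ M) :
    ∃ u : X.Space hB, ∀ S : Set (X.Space hB), Convex ℝ S → IsClosed S →
      (∀ᶠ n in atTop, f n ∈ S) → u ∈ S := by
  have hψM : ∀ (ψ : StrongDual ℝ (X.Space hB)) n, ‖ψ (f n)‖ ≤ M * ‖ψ‖ := fun ψ n => by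
    rw [mul_comm]
    exact (ψ.le_opNorm _).trans (mul_le_mul_of_nonneg_left (hM n) (norm_nonneg _))
  have hlim : ∀ ψ : StrongDual ℝ (X.Space hB), ∃ L,
      Tendsto (fun n => ψ (f n)) (hyperfilter ℕ) (𝓝 L) := fun ψ => by
    obtain ⟨L, -, hL⟩ := (isCompact_closedBall (0 : ℝ) (M * ‖ψ‖)).ultrafilter_le_nhds
      ((hyperfilter ℕ).map fun n => ψ (f n)) (le_principal_iff.2
        (Ultrafilter.mem_map.2 (Eventually.of_forall fun n => by simpa using hψM ψ n)))
    exact ⟨L, hL⟩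
  choose L hL using hlim
  let Φ : StrongDual ℝ (StrongDual ℝ (X.Space hB)) := LinearMap.mkContinuous
    { toFun := L
      map_add' := fun ψ χ => tendsto_nhds_unique (hL (ψ + χ)) ((hL ψ).add (hL χ))
      map_smul' := fun c ψ => tendsto_nhds_unique (hL (c • ψ)) ((hL ψ).const_mul c) }
    M (fun ψ => le_of_tendsto' (hL ψ).norm (hψM ψ))
  obtain ⟨u, hu⟩ := hR.exists_forall_apply_eq Φ
  refine ⟨u, fun S hS hSc hev => ?_⟩
  by_contra hnot
  obtain ⟨ψ, c, hψS, hψu⟩ := geometric_hahn_banach_closed_point hS hSc hnot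
  have hle : L ψ ≤ c := le_of_tendsto (hL ψ)
    ((hev.filter_mono Nat.hyperfilter_le_atTop).mono fun n hn => (hψS _ hn).le)
  exact (hψu.trans_le ((hu ψ).symm.trans_le hle)).false

lemma QBFS.Space.isClosed_setOf_ae_le {f : Ω → ℝ} (hf : f ∈ X.carrier) :
    IsClosed {h : X.Space hB | ∀ᵐ x ∂μ, f x ≤ h.1 x} := by
  refine isClosed_of_closure_subset fun g hg => ?_
  refine QBFS.ae_le_of_forall_qnorm_sub_lt hf g.2 fun ε hε => ?_
  obtain ⟨u, hu, hlt⟩ := Metric.mem_closure_iff.1 hg ε hε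
  refine ⟨u.1, u.2, hu, ?_⟩
  rw [dist_comm, dist_eq_norm] at hlt
  exact hlt

lemma QBFS.Space.convex_setOf_ae_le (f : Ω → ℝ) :
    Convex ℝ {h : X.Space hB | ∀ᵐ x ∂μ, f x ≤ h.1 x} := by
  intro u hu v hv a b ha hb hab
  change ∀ᵐ x ∂μ, f x ≤ a * u.1 x + b * v.1 x
  filter_upwards [hu, hv] with x (hx : f x ≤ u.1 x) (hx' : f x ≤ v.1 x)
  calc f x = a * f x + b * f x := by rw [← add_mul, hab, one_mul]
    _ ≤ a * u.1 x + b * v.1 x :=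
      add_le_add (mul_le_mul_of_nonneg_left hx ha) (mul_le_mul_of_nonneg_left hx' hb)

lemma IsReflexive.fatou (hB : X.IsBanach) (hR : IsReflexive X) : X.Fatou := by
  intro f g hf hgm hfg hbdd
  obtain ⟨u, hu⟩ := hR.exists_weak_cluster (hB := hB) (f := fun n => ⟨f n, hf n⟩)
    (M := ⨆ n, X.qnorm (f n)) (fun n => le_ciSup hbdd n)
  have hfu : ∀ n, ∀ᵐ x ∂μ, f n x ≤ u.1 x := fun n =>
    hu _ (QBFS.Space.convex_setOf_ae_le (f n)) (QBFS.Space.isClosed_setOf_ae_le (hf n))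
      (eventually_atTop.2 ⟨n, fun m hm => hfg.mono fun x hx => hx.2.1 hm⟩)
  have huM : X.qnorm u.1 ≤ ⨆ n, X.qnorm (f n) := by
    have := hu (Metric.closedBall 0 (⨆ n, X.qnorm (f n))) (convex_closedBall _ _)
      Metric.isClosed_closedBall
      (Eventually.of_forall fun n => mem_closedBall_zero_iff.2 (le_ciSup hbdd n))
    exact mem_closedBall_zero_iff.1 this
  have hg0 : ∀ᵐ x ∂μ, ∀ n, 0 ≤ f n x ∧ f n x ≤ g x := hfg.mono fun x hx n =>
    ⟨hx.1.trans (hx.2.1 n.zero_le), hx.2.1.ge_of_tendsto hx.2.2 n⟩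
  obtain ⟨hg, hgu⟩ := X.ideal u.1 u.2 g hgm (by
    filter_upwards [hfg, hg0, ae_all_iff.2 hfu] with x hx hx0 hxu
    rw [abs_of_nonneg ((hx0 0).1.trans (hx0 0).2)]
    exact (le_of_tendsto' hx.2.2 hxu).trans (le_abs_self _))
  refine ⟨hg, le_antisymm (hgu.trans huM) (ciSup_le fun n => ?_)⟩
  refine (X.ideal g hg _ (X.aemeasurable_mem _ (hf n)) (hg0.mono fun x hx => ?_)).2
  rw [abs_of_nonneg (hx n).1]
  exact (hx n).2.trans (le_abs_self _)

lemma IsReflexive.orderContinuous (hB : X.IsBanach) (hR : IsReflexive X) :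
    X.OrderContinuous := by
  intro f hf hlim
  have hf0 : ∀ᵐ x ∂μ, ∀ n, 0 ≤ f n x := hlim.mono fun x hx n => hx.1.le_of_tendsto hx.2 n
  have hmono : ∀ n, ∀ u ∈ X.carrier, (∀ᵐ x ∂μ, f n x ≤ u x) → X.qnorm (f n) ≤ X.qnorm u :=
    fun n u hu hle => (X.ideal u hu _ (X.aemeasurable_mem _ (hf n)) (by
      filter_upwards [hf0, hle] with x hx hx'
      rw [abs_of_nonneg (hx n)]
      exact hx'.trans (le_abs_self _))).2
  have hanti : ∀ m n, m ≤ n → ∀ᵐ x ∂μ, f n x ≤ f m x := fun m n hmn =>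
    hlim.mono fun x hx => hx.1 hmn
  obtain ⟨u, hu⟩ := hR.exists_weak_cluster (hB := hB) (f := fun n => ⟨f n, hf n⟩)
    (M := X.qnorm (f 0)) (fun n => hmono n _ (hf 0) (hanti 0 n n.zero_le))
  have hu0 : ∀ᵐ x ∂μ, 0 ≤ u.1 x :=
    hu _ (QBFS.Space.convex_setOf_ae_le 0) (QBFS.Space.isClosed_setOf_ae_le X.zero_mem)
      (Eventually.of_forall fun n => hf0.mono fun x hx => hx n)
  have huf : ∀ n, ∀ᵐ x ∂μ, u.1 x ≤ f n x := fun n => by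
    have hmem := hu ((-·) ⁻¹' {h | ∀ᵐ x ∂μ, (-f n) x ≤ h.1 x})
      ((QBFS.Space.convex_setOf_ae_le (-f n)).neg)
      ((QBFS.Space.isClosed_setOf_ae_le (QBFS.neg_mem (hf n))).preimage continuous_neg)
      (eventually_atTop.2 ⟨n, fun m hm => (hanti n m hm).mono fun x hx => neg_le_neg hx⟩)
    exact (show ∀ᵐ x ∂μ, -f n x ≤ -u.1 x from hmem).mono fun x hx => neg_le_neg_iff.1 hx
  have hunorm : ‖u‖ = 0 := by
    refine (X.qnorm_eq_zero_iff u.1 u.2).2 ?_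
    filter_upwards [hu0, ae_all_iff.2 huf, hlim] with x h0 hx hx'
    exact le_antisymm (ge_of_tendsto' hx'.2 hx) h0
  set C : Set (X.Space hB) := {h | ∃ n, ∀ᵐ x ∂μ, f n x ≤ h.1 x}
  have hC : Convex ℝ C := by
    rintro h ⟨m, hm⟩ k ⟨n, hn⟩ a b ha hb hab
    refine ⟨max m n, QBFS.Space.convex_setOf_ae_le (f (max m n)) ?_ ?_ ha hb hab⟩
    · filter_upwards [hm, hanti m _ (le_max_left m n)] with x h1 h2 using h2.trans h1
    · filter_upwards [hn, hanti n _ (le_max_right m n)] with x h1 h2 using h2.trans h1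
  have huC : u ∈ closure C := hu _ hC.closure isClosed_closure
    (Eventually.of_forall fun n => subset_closure ⟨n, ae_of_all _ fun x => le_rfl⟩)
  refine Metric.tendsto_atTop.2 fun ε hε => ?_
  obtain ⟨h, ⟨n, hn⟩, hlt⟩ := Metric.mem_closure_iff.1 huC ε hε
  refine ⟨n, fun m hm => ?_⟩
  rw [Real.dist_eq, sub_zero, abs_of_nonneg (X.qnorm_nonneg _ (hf m))]
  refine (hmono m _ (hf n) (hanti n m hm)).trans_lt ((hmono n _ h.2 hn).trans_lt ?_)
  calc ‖h‖ ≤ ‖u‖ + ‖u - h‖ := norm_le_norm_add_norm_sub _ _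
    _ < ε := by rwa [hunorm, zero_add, ← dist_eq_norm]

lemma IsReflexive.dualOrderContinuous (hB : X.IsBanach) (hR : IsReflexive X) :
    DualOrderContinuous X := by
  intro g hg hlim
  have hg0 : ∀ᵐ x ∂μ, ∀ n, 0 ≤ g n x := hlim.mono fun x hx n => hx.1.le_of_tendsto hx.2 n
  have hanti : ∀ m n, m ≤ n → ∀ᵐ x ∂μ, g n x ≤ g m x := fun m n hmn =>
    hlim.mono fun x hx => hx.1 hmn
  have hdanti : ∀ m n, m ≤ n → X.dualNorm (g n) ≤ X.dualNorm (g m) := fun m n hmn =>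
    QBFS.dualNorm_mono hB (hg m) (hg n).1 (by
      filter_upwards [hg0, hanti m n hmn] with x hx hx'
      rwa [abs_of_nonneg (hx n), abs_of_nonneg (hx m)])
  refine Metric.tendsto_atTop.2 fun ε hε => ?_
  suffices h : ∃ N, X.dualNorm (g N) < ε by
    obtain ⟨N, hN⟩ := h
    refine ⟨N, fun n hn => ?_⟩
    rw [Real.dist_eq, sub_zero, abs_of_nonneg (QBFS.dualNorm_nonneg X _)]
    exact (hdanti N n hn).trans_lt hN
  by_contra! hge
  set C : Set (StrongDual ℝ (X.Space hB)) :=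
    {ψ | ∃ n, ∀ f : X.Space hB, (∀ x, 0 ≤ f.1 x) → ∫ x, f.1 x * g n x ∂μ ≤ ψ f}
  have hint : ∀ m n, m ≤ n → ∀ f : X.Space hB, (∀ x, 0 ≤ f.1 x) →
      ∫ x, f.1 x * g n x ∂μ ≤ ∫ x, f.1 x * g m x ∂μ := fun m n hmn f hf0 =>
    integral_mono_ae ((hg n).2 _ f.2) ((hg m).2 _ f.2)
      ((hanti m n hmn).mono fun x hx => mul_le_mul_of_nonneg_left hx (hf0 x))
  have hC : Convex ℝ C := by
    rintro ψ ⟨m, hm⟩ χ ⟨n, hn⟩ a b ha hb hab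
    refine ⟨max m n, fun f hf0 => ?_⟩
    have h1 := (hint m _ (le_max_left m n) f hf0).trans (hm f hf0)
    have h2 := (hint n _ (le_max_right m n) f hf0).trans (hn f hf0)
    calc ∫ x, f.1 x * g (max m n) x ∂μ
        = a * (∫ x, f.1 x * g (max m n) x ∂μ) + b * ∫ x, f.1 x * g (max m n) x ∂μ := by
          rw [← add_mul, hab, one_mul]
      _ ≤ a * ψ f + b * χ f :=
        add_le_add (mul_le_mul_of_nonneg_left h1 ha) (mul_le_mul_of_nonneg_left h2 hb)
  have hnorm : ∀ ψ ∈ C, ε ≤ ‖ψ‖ := by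
    rintro ψ ⟨n, hn⟩
    refine (hge n).trans (QBFS.dualNorm_le (norm_nonneg _) (hg n).1 fun f hf => ?_)
    calc |∫ x, f x * g n x ∂μ| ≤ ∫ x, |f x * g n x| ∂μ := abs_integral_le_integral_abs
      _ = ∫ x, |f x| * g n x ∂μ := integral_congr_ae (hg0.mono fun x hx => by
          simp only [abs_mul, abs_of_nonneg (hx n)])
      _ ≤ ψ ⟨_, QBFS.abs_mem hf⟩ := hn ⟨_, QBFS.abs_mem hf⟩ fun x => abs_nonneg _
      _ ≤ ‖ψ‖ * X.qnorm (fun x => |f x|) := (le_abs_self _).trans (ψ.le_opNorm _)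
      _ = ‖ψ‖ * X.qnorm f := by rw [QBFS.qnorm_abs hf]
  have h0 : (0 : StrongDual ℝ (X.Space hB)) ∉ closure C := by
    intro hmem
    obtain ⟨ψ, hψ, hlt⟩ := Metric.mem_closure_iff.1 hmem ε hε
    rw [dist_zero_left] at hlt
    exact (hnorm ψ hψ).not_gt hlt
  obtain ⟨Φ, c, hc0, hcC⟩ := geometric_hahn_banach_point_closed hC.closure isClosed_closure h0
  obtain ⟨f, hf⟩ := hR.exists_forall_apply_eq Φ
  have hlower : ∀ n, c ≤ ∫ x, f.1 x * g n x ∂μ := fun n => by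
    have hmem : QBFS.Space.toDual hB (QBFS.isBddLinFunctional_integral hB (hg n)) ∈ C :=
      ⟨n, fun _ _ => le_rfl⟩
    have := hcC _ (subset_closure hmem)
    rw [hf] at this
    exact this.le
  have hto : Tendsto (fun n => ∫ x, f.1 x * g n x ∂μ) atTop (𝓝 0) := by
    have := tendsto_integral_of_dominated_convergence (μ := μ) (F := fun n x => f.1 x * g n x)
      (f := fun _ => (0 : ℝ)) (fun x => |f.1 x * g 0 x|)
      (fun n => ((hg n).2 _ f.2).aestronglyMeasurable) (QBFS.integrable_abs_mul (hg 0) f.2)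
      (fun n => by
        filter_upwards [hg0, hanti 0 n n.zero_le] with x hx hx'
        rw [Real.norm_eq_abs, abs_mul, abs_mul, abs_of_nonneg (hx n), abs_of_nonneg (hx 0)]
        exact mul_le_mul_of_nonneg_left hx' (abs_nonneg _))
      (hlim.mono fun x hx => by simpa using hx.2.const_mul (f.1 x))
    simpa using this
  rw [map_zero] at hc0
  exact (hc0.trans_le (ge_of_tendsto' hto hlower)).false

end Reflexive

/-- A Banach function space is reflexive if and only if it has the Fatou
property and both `X` and `X'` are order-continuous. -/
theorem reflexive_iff_fatou_and_orderContinuous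
    [SigmaFinite μ] (X : QBFS μ) (hB : X.IsBanach) :
    IsReflexive X ↔ (X.Fatou ∧ X.OrderContinuous ∧ DualOrderContinuous X) := by
  exact ⟨fun hR => ⟨hR.fatou hB, hR.orderContinuous hB, hR.dualOrderContinuous hB⟩,
    fun h => isReflexive_of_fatou_of_orderContinuous hB h.1 h.2.1 h.2.2⟩
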